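/- Let n1, n2 ≥ 2 be integers with n1·n2 even, and let τ1, τ2 ∈ ℝ be such that there exist z1, z2 ∈ ℂ with z1² = τ1, z2² = τ2 and the pair (z1,z2) (n1,n2)-independent. Then for every integer s ≥ 1, the 2n1n2 row vectors e1·Q^s, e1·Q^{s+1}, …, e1·Q^{s+2n1n2−1} in ℝ^{2n1n2} are linearly independent, where Q = Q(n1,n2,τ1,τ2). -/

import Mathlib

open Matrix Kronecker

noncomputable section

/-- The modified Kac matrix `𝒦(n,y)`: its 1-based entry `(i,j)` equals `(n-j)·y` if `j = i-1`,
equals `i` if `j = i+1`, and equals `0` otherwise. -/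
def kacM (R : Type*) [CommRing R] (n : ℕ) (y : R) : Matrix (Fin n) (Fin n) R :=
  Matrix.of fun i j =>
    if (i : ℕ) = (j : ℕ) + 1 then ((n - 1 - (j : ℕ) : ℕ) : R) * y
    else if (j : ℕ) = (i : ℕ) + 1 then (((i : ℕ) + 1 : ℕ) : R)
    else 0

/-- The modified Kac matrix of second type `K(n1,n2,x,y)`, indexed by pairs
`(block index, index inside block)`; the pair `(u,v)` (0-based) corresponds to the
1-based position `u·n2 + v + 1`.  Its `n2×n2` blocks `K_{ij}` (1-based) are
`𝒦(n2,y)` if `i = j`, `(n1-j)·x·I` if `j = i-1`, `i·I` if `j = i+1`, and `0` otherwise. -/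
def kac2M (R : Type*) [CommRing R] (n1 n2 : ℕ) (x y : R) :
    Matrix (Fin n1 × Fin n2) (Fin n1 × Fin n2) R :=
  Matrix.of fun p q =>
    if p.1 = q.1 then kacM R n2 y p.2 q.2
    else if (p.1 : ℕ) = (q.1 : ℕ) + 1 then
      (if p.2 = q.2 then ((n1 - 1 - (q.1 : ℕ) : ℕ) : R) * x else 0)
    else if (q.1 : ℕ) = (p.1 : ℕ) + 1 then
      (if p.2 = q.2 then (((p.1 : ℕ) + 1 : ℕ) : R) else 0)
    else 0

/-- A pair `(z1,z2)` of complex numbers is `(n1,n2)`-independent if, for all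
`a1, b1 ∈ 𝒩₁ = {n1-1-2r : 0 ≤ r ≤ n1-1}` and `a2, b2 ∈ 𝒩₂ = {n2-1-2r : 0 ≤ r ≤ n2-1}`,
`(a1-b1)z1 + (a2-b2)z2 = 0` implies `a1 = b1` and `a2 = b2`. -/
def IndepPair (n1 n2 : ℕ) (z1 z2 : ℂ) : Prop :=
  ∀ a1 b1 a2 b2 : ℤ,
    (∃ r : ℕ, r < n1 ∧ a1 = (n1 : ℤ) - 1 - 2 * r) →
    (∃ r : ℕ, r < n1 ∧ b1 = (n1 : ℤ) - 1 - 2 * r) →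
    (∃ r : ℕ, r < n2 ∧ a2 = (n2 : ℤ) - 1 - 2 * r) →
    (∃ r : ℕ, r < n2 ∧ b2 = (n2 : ℤ) - 1 - 2 * r) →
    ((a1 - b1 : ℤ) : ℂ) * z1 + ((a2 - b2 : ℤ) : ℂ) * z2 = 0 →
    a1 = b1 ∧ a2 = b2

/-- `K(n1,n2,x,y)` as a matrix indexed by `Fin (n1·n2)`, placing the pair `(u,v)` at the
0-based position `u·n2 + v`. -/
def kac2Fin (n1 n2 : ℕ) (x y : ℝ) : Matrix (Fin (n1 * n2)) (Fin (n1 * n2)) ℝ :=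
  Matrix.reindex finProdFinEquiv finProdFinEquiv (kac2M ℝ n1 n2 x y)

/-- The matrix `Q(n1,n2,τ1,τ2) = [[K, I],[0, K]]` (blocks of order `n1·n2`),
where `K = K(n1,n2,τ1,τ2)`, indexed by `Fin (2·n1·n2)`. -/
def Qmat (n1 n2 : ℕ) (τ1 τ2 : ℝ) :
    Matrix (Fin (2 * (n1 * n2))) (Fin (2 * (n1 * n2))) ℝ :=
  Matrix.reindex (finSumFinEquiv.trans (finCongr (two_mul (n1 * n2)).symm))
    (finSumFinEquiv.trans (finCongr (two_mul (n1 * n2)).symm))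
    (Matrix.fromBlocks (kac2Fin n1 n2 τ1 τ2) 1 0 (kac2Fin n1 n2 τ1 τ2))

/-- The first standard basis row vector `e1 = (1,0,…,0)` of `ℝ^n`. -/
def e1v (n : ℕ) : Fin n → ℝ := fun i => if (i : ℕ) = 0 then 1 else 0

/-- The `(2n1n2-1) × (2n1n2)` matrix `M̄(n1,n2,τ1,τ2)` whose `i`-th row (1-based) is
the row vector `e1·Q^{i+1}`. -/
def Mbar (n1 n2 : ℕ) (τ1 τ2 : ℝ) :
    Matrix (Fin (2 * (n1 * n2) - 1)) (Fin (2 * (n1 * n2))) ℝ :=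
  Matrix.of fun i j =>
    Matrix.vecMul (e1v (2 * (n1 * n2))) (Qmat n1 n2 τ1 τ2 ^ ((i : ℕ) + 2)) j

/-- The square matrix `M(n1,n2,τ1,τ2)` of order `2n1n2-1` obtained from `M̄` by deleting
its first column. -/
def Mmat (n1 n2 : ℕ) (τ1 τ2 : ℝ) :
    Matrix (Fin (2 * (n1 * n2) - 1)) (Fin (2 * (n1 * n2) - 1)) ℝ :=
  Matrix.of fun i j =>
    Mbar n1 n2 τ1 τ2 i ⟨(j : ℕ) + 1, by have := j.isLt; omega⟩

/-- Generating polynomial of a right eigenvector of the Kac matrix. -/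
def kacPoly (m r : ℕ) (z : ℂ) : Polynomial ℂ :=
  (1 + Polynomial.C z * Polynomial.X) ^ (m - r) * (1 - Polynomial.C z * Polynomial.X) ^ r

lemma kacPoly_ode (m r : ℕ) (hr : r ≤ m) (z : ℂ) :
    (1 - Polynomial.C (z ^ 2) * Polynomial.X ^ 2) * Polynomial.derivative (kacPoly m r z)
      + Polynomial.C ((m : ℂ) * z ^ 2) * (Polynomial.X * kacPoly m r z)
      = Polynomial.C (((m : ℂ) - 2 * r) * z) * kacPoly m r z := by
  obtain ⟨a, rfl⟩ := Nat.exists_eq_add_of_le hr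
  have : r + a - r = a := by omega
  unfold kacPoly
  rw [this]
  simp only [Polynomial.derivative_mul, Polynomial.derivative_pow, Polynomial.derivative_add,
    Polynomial.derivative_sub, Polynomial.derivative_one, Polynomial.derivative_C,
    Polynomial.derivative_X]
  simp only [Polynomial.C_mul, Polynomial.C_add, Polynomial.C_sub, Polynomial.C_pow,
    Nat.cast_add, Polynomial.C_ofNat, map_natCast]
  rcases a with _ | a <;> rcases r with _ | r <;>
    simp only [Nat.add_sub_cancel, Nat.cast_add, Nat.cast_zero, Nat.cast_one, map_add, map_one,
      map_zero, map_natCast, Polynomial.C_ofNat] <;> ring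

lemma kacPoly_coeff_zero (m r : ℕ) (z : ℂ) : (kacPoly m r z).coeff 0 = 1 := by
  simp [kacPoly, Polynomial.coeff_zero_eq_eval_zero]

lemma kacPoly_coeff_large (m r : ℕ) (hr : r ≤ m) (z : ℂ) (k : ℕ) (hk : m < k) :
    (kacPoly m r z).coeff k = 0 := by
  apply Polynomial.coeff_eq_zero_of_natDegree_lt
  refine lt_of_le_of_lt ?_ hk
  have h1 : (1 + Polynomial.C z * Polynomial.X : Polynomial ℂ).natDegree ≤ 1 := by
    compute_degree
  have h2 : (1 - Polynomial.C z * Polynomial.X : Polynomial ℂ).natDegree ≤ 1 := by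
    compute_degree
  have h3 := Polynomial.natDegree_pow_le_of_le (m - r) h1
  have h4 := Polynomial.natDegree_pow_le_of_le r h2
  have h5 := Polynomial.natDegree_mul_le_of_le h3 h4
  unfold kacPoly
  omega

lemma kacPoly_rec (m r : ℕ) (hr : r ≤ m) (z : ℂ) (i : ℕ) :
    ((i : ℂ) + 1) * (kacPoly m r z).coeff (i + 1)
      + (if i = 0 then 0 else ((m : ℂ) - (i - 1)) * z ^ 2 * (kacPoly m r z).coeff (i - 1))
      = ((m : ℂ) - 2 * r) * z * (kacPoly m r z).coeff i := by
  have h := congrArg (fun p => Polynomial.coeff p i) (kacPoly_ode m r hr z)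
  simp only [sub_mul, one_mul, Polynomial.coeff_add, Polynomial.coeff_sub, Polynomial.coeff_C_mul,
    mul_assoc, Polynomial.coeff_derivative] at h
  rcases i with _ | _ | i
  · simp [Polynomial.coeff_X_pow_mul', Polynomial.coeff_derivative] at h ⊢
    linear_combination h
  · simp [Polynomial.coeff_X_pow_mul', Polynomial.coeff_X_mul, Polynomial.coeff_derivative] at h ⊢
    linear_combination h
  · simp [Polynomial.coeff_X_pow_mul', Polynomial.coeff_X_mul, Polynomial.coeff_derivative] at h ⊢
    linear_combination h

/-- The right eigenvector. -/
def kacVec (n r : ℕ) (z : ℂ) : Fin n → ℂ := fun i => (kacPoly (n - 1) r z).coeff i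

lemma kacM_mulVec (n r : ℕ) (hr : r < n) (z : ℂ) :
    kacM ℂ n (z ^ 2) *ᵥ kacVec n r z = (((n : ℂ) - 1 - 2 * r) * z) • kacVec n r z := by
  have hn : ((n - 1 : ℕ) : ℂ) = (n : ℂ) - 1 := by
    rw [Nat.cast_sub (by omega)]; simp
  funext i
  have hrec := kacPoly_rec (n - 1) r (by omega) z i
  have hi := i.isLt
  rw [hn] at hrec
  simp only [Pi.smul_apply, smul_eq_mul, kacVec]
  rw [← hrec]
  simp only [Matrix.mulVec, dotProduct, kacM, Matrix.of_apply, kacVec]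
  rw [Fin.sum_univ_eq_sum_range (fun j : ℕ => (if (i : ℕ) = j + 1 then
    ((n - 1 - j : ℕ) : ℂ) * z ^ 2 else if j = (i : ℕ) + 1 then (((i : ℕ) + 1 : ℕ) : ℂ) else 0) *
      (kacPoly (n - 1) r z).coeff j) n]
  have hsplit : ∀ j ∈ Finset.range n, (if (i : ℕ) = j + 1 then
      ((n - 1 - j : ℕ) : ℂ) * z ^ 2 else if j = (i : ℕ) + 1 then (((i : ℕ) + 1 : ℕ) : ℂ) else 0) *
      (kacPoly (n - 1) r z).coeff j =
      (if j = (i : ℕ) + 1 then ((i : ℂ) + 1) * (kacPoly (n - 1) r z).coeff (i + 1) else 0) +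
      (if j = (i : ℕ) - 1 then (if (i : ℕ) = 0 then 0 else
        (((n : ℂ) - 1) - (i - 1)) * z ^ 2 * (kacPoly (n - 1) r z).coeff (i - 1)) else 0) := by
    intro j hj
    by_cases h : (i : ℕ) = j + 1
    · have h' : j < n := Finset.mem_range.1 hj
      have e : ((n - 1 - j : ℕ) : ℂ) = (n : ℂ) - 1 - j := by
        rw [Nat.cast_sub (by omega), hn]
      simp [h, e]
      omega
    · by_cases h2 : j = (i : ℕ) + 1
      · have : j ≠ (i : ℕ) - 1 := by omega
        subst h2
        have h3 : ¬ (i : ℕ) = (i : ℕ) + 1 + 1 := by omega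
        simp [h3]
        omega
      · by_cases h3 : (i : ℕ) = 0
        · have h4 : j ≠ 1 := by omega
          simp [h3, h4]
        · have : j ≠ (i : ℕ) - 1 := by omega
          simp [h, h2, this]
  rw [Finset.sum_congr rfl hsplit, Finset.sum_add_distrib, Finset.sum_ite_eq', Finset.sum_ite_eq']
  congr 1
  · split_ifs with h
    · rfl
    · rw [kacPoly_coeff_large _ _ (by omega) _ _ (by simp at h; omega)]; simp
  · rw [if_pos (by simp; omega)]

lemma kac2M_apply (n1 n2 : ℕ) (x y : ℂ) (p q : Fin n1 × Fin n2) :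
    kac2M ℂ n1 n2 x y p q = kacM ℂ n1 x p.1 q.1 * (if p.2 = q.2 then 1 else 0)
      + (if p.1 = q.1 then 1 else 0) * kacM ℂ n2 y p.2 q.2 := by
  obtain ⟨p1, p2⟩ := p
  obtain ⟨q1, q2⟩ := q
  by_cases h : p1 = q1
  · subst h
    simp [kac2M, kacM]
  · by_cases h2 : p2 = q2
    · subst h2; simp [kac2M, kacM, h]
    · simp [kac2M, h, h2]

lemma kac2M_mulVec (n1 n2 : ℕ) (x y l1 l2 : ℂ) (a : Fin n1 → ℂ) (b : Fin n2 → ℂ)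
    (ha : kacM ℂ n1 x *ᵥ a = l1 • a) (hb : kacM ℂ n2 y *ᵥ b = l2 • b) :
    kac2M ℂ n1 n2 x y *ᵥ (fun p => a p.1 * b p.2) = (l1 + l2) • (fun p => a p.1 * b p.2) := by
  funext ⟨i, j⟩
  have ha' := congrFun ha i
  have hb' := congrFun hb j
  simp only [Matrix.mulVec, dotProduct, Pi.smul_apply, smul_eq_mul] at ha' hb' ⊢
  rw [Fintype.sum_prod_type]
  have e : ∀ u : Fin n1, ∑ v : Fin n2, kac2M ℂ n1 n2 x y (i, j) (u, v) * (a u * b v)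
      = kacM ℂ n1 x i u * a u * b j + (if i = u then a u * (l2 * b j) else 0) := by
    intro u
    simp only [kac2M_apply, add_mul, Finset.sum_add_distrib]
    congr 1
    · simp
      ring
    · split_ifs with h
      · rw [← hb', Finset.mul_sum]
        refine Finset.sum_congr rfl fun v _ => by ring
      · simp
  simp only [e, Finset.sum_add_distrib, ← Finset.sum_mul, ha']
  simp
  ring

lemma kac2M_map (n1 n2 : ℕ) (x y : ℝ) :
    (kac2M ℝ n1 n2 x y).map (algebraMap ℝ ℂ) = kac2M ℂ n1 n2 (x : ℂ) (y : ℂ) := by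
  ext p q
  simp only [Matrix.map_apply, kac2M, kacM, Matrix.of_apply, Complex.coe_algebraMap]
  split_ifs <;> simp

/-- The index equivalence. -/
def idxE (n1 n2 : ℕ) : (Fin n1 × Fin n2) ⊕ (Fin n1 × Fin n2) ≃ Fin (2 * (n1 * n2)) :=
  (Equiv.sumCongr finProdFinEquiv finProdFinEquiv).trans
    (finSumFinEquiv.trans (finCongr (two_mul (n1 * n2)).symm))

lemma Qmat_map (n1 n2 : ℕ) (x y : ℝ) :
    (Qmat n1 n2 x y).map (algebraMap ℝ ℂ) =
      (Matrix.fromBlocks (kac2M ℂ n1 n2 x y) 1 0 (kac2M ℂ n1 n2 x y)).submatrix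
        (idxE n1 n2).symm (idxE n1 n2).symm := by
  rw [← kac2M_map]
  ext i j
  obtain ⟨i, rfl⟩ := (idxE n1 n2).surjective i
  obtain ⟨j, rfl⟩ := (idxE n1 n2).surjective j
  simp only [Matrix.submatrix_apply, Equiv.symm_apply_apply, Matrix.map_apply]
  have hE : ∀ t, (finSumFinEquiv.trans (finCongr (two_mul (n1 * n2)).symm)).symm (idxE n1 n2 t)
      = Sum.map finProdFinEquiv finProdFinEquiv t := by
    intro t
    rw [Equiv.symm_apply_eq]
    rfl
  rw [Qmat, Matrix.reindex_apply, Matrix.submatrix_apply, hE, hE]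
  rcases i with i | i <;> rcases j with j | j <;>
    simp [kac2Fin, Matrix.one_apply, -finProdFinEquiv_apply_val]

lemma pow_chain {ι : Type*} [Fintype ι] [DecidableEq ι] (A : Matrix ι ι ℂ) (l : ℂ) (w1 w2 : ι → ℂ)
    (h1 : A *ᵥ w1 = l • w1) (h2 : A *ᵥ w2 = w1 + l • w2) (k : ℕ) :
    (A ^ k) *ᵥ w1 = l ^ k • w1 ∧ (A ^ k) *ᵥ w2 = l ^ k • w2 + ((k : ℂ) * l ^ (k - 1)) • w1 := by
  induction k with
  | zero => simp
  | succ k ih =>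
    rw [pow_succ', ← Matrix.mulVec_mulVec, ← Matrix.mulVec_mulVec, ih.1, ih.2]
    simp only [Matrix.mulVec_add, Matrix.mulVec_smul, h1, h2]
    refine ⟨?_, ?_⟩
    · rw [smul_smul, pow_succ]
    · funext i
      simp only [Pi.add_apply, Pi.smul_apply, smul_eq_mul]
      rcases k with _ | k
      · simp; ring
      · simp; ring

lemma poly_part {ι : Type*} [Fintype ι] (N s : ℕ) (lam : ι → ℂ) (hinj : Function.Injective lam)
    (hN : Fintype.card ι = N) (h0 : ∀ i, lam i ≠ 0) (c : Fin (2 * N) → ℂ)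
    (hc1 : ∀ i, ∑ k, c k * lam i ^ (s + (k : ℕ)) = 0)
    (hc2 : ∀ i, ∑ k, c k * (((s + (k : ℕ) : ℕ) : ℂ) * lam i ^ (s + (k : ℕ) - 1)) = 0) :
    ∀ k, c k = 0 := by
  classical
  set q : Polynomial ℂ := ∑ k : Fin (2 * N), Polynomial.C (c k) * Polynomial.X ^ (k : ℕ) with hq
  have hp : Polynomial.X ^ s * q = ∑ k : Fin (2 * N),
      Polynomial.C (c k) * Polynomial.X ^ (s + (k : ℕ)) := by
    rw [hq, Finset.mul_sum]
    refine Finset.sum_congr rfl fun k _ => by ring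
  have hdeg : q.degree < (2 * N : ℕ) := by
    rw [hq]
    refine lt_of_le_of_lt (Polynomial.degree_sum_le _ _) ?_
    rw [Finset.sup_lt_iff (WithBot.bot_lt_coe _)]
    intro k _
    refine lt_of_le_of_lt (Polynomial.degree_C_mul_X_pow_le _ _) ?_
    exact_mod_cast k.isLt
  have hroot : ∀ i, (Polynomial.X - Polynomial.C (lam i)) ^ 2 ∣ q := by
    intro i
    have e1 : (Polynomial.X ^ s * q).eval (lam i) = 0 := by
      rw [hp, Polynomial.eval_finsetSum]
      simpa using hc1 i
    have e2 : (Polynomial.derivative (Polynomial.X ^ s * q)).eval (lam i) = 0 := by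
      rw [hp, Polynomial.derivative_sum, Polynomial.eval_finsetSum]
      simpa [Polynomial.derivative_X_pow] using hc2 i
    have hne : lam i ^ s ≠ 0 := pow_ne_zero _ (h0 i)
    have e3 : q.eval (lam i) = 0 := by
      simpa [h0 i] using e1
    have e4 : (Polynomial.derivative q).eval (lam i) = 0 := by
      simpa [Polynomial.derivative_mul, e3, h0 i] using e2
    by_cases hq0 : q = 0
    · rw [hq0]; exact dvd_zero _
    · rw [← Polynomial.le_rootMultiplicity_iff hq0]
      exact (Polynomial.one_lt_rootMultiplicity_iff_isRoot hq0).2 ⟨e3, e4⟩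
  have hdvd : (∏ i, (Polynomial.X - Polynomial.C (lam i)) ^ 2) ∣ q := by
    apply Finset.prod_dvd_of_coprime
    · intro i _ j _ hij
      exact (Polynomial.isCoprime_X_sub_C_of_isUnit_sub
        (sub_ne_zero.2 (hinj.ne hij)).isUnit).pow
    · intro i _; exact hroot i
  have hq0 : q = 0 := by
    apply Polynomial.eq_zero_of_dvd_of_degree_lt hdvd
    refine lt_of_lt_of_eq hdeg ?_
    rw [Polynomial.degree_prod]
    simp [Polynomial.degree_pow, hN, mul_comm]
  intro k
  have := congrArg (fun p => Polynomial.coeff p (k : ℕ)) hq0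
  simp only [hq, Polynomial.finsetSum_coeff, Polynomial.coeff_C_mul_X_pow,
    Polynomial.coeff_zero] at this
  simpa [Fin.val_inj] using this

/-- If `n1·n2` is even and `τ1 = z1²`, `τ2 = z2²` with `(z1,z2)`
`(n1,n2)`-independent, then for every `s ≥ 1` the `2n1n2` row vectors
`e1·Q^s, e1·Q^{s+1}, …, e1·Q^{s+2n1n2-1}` are linearly independent. -/
theorem rows_linearIndependent_even (n1 n2 : ℕ) (h1 : 2 ≤ n1) (h2 : 2 ≤ n2)
    (heven : Even (n1 * n2)) (τ1 τ2 : ℝ) (z1 z2 : ℂ)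
    (hz1 : z1 ^ 2 = (τ1 : ℂ)) (hz2 : z2 ^ 2 = (τ2 : ℂ))
    (hind : IndepPair n1 n2 z1 z2) (s : ℕ) (hs : 1 ≤ s) :
    LinearIndependent ℝ (fun k : Fin (2 * (n1 * n2)) =>
      Matrix.vecMul (e1v (2 * (n1 * n2))) (Qmat n1 n2 τ1 τ2 ^ (s + (k : ℕ)))) := by
  classical
  have hprod : 0 < n1 * n2 := by positivity
  set A : Matrix (Fin (2 * (n1 * n2))) (Fin (2 * (n1 * n2))) ℂ :=
    (Qmat n1 n2 τ1 τ2).map (algebraMap ℝ ℂ) with hA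
  set lam : Fin n1 × Fin n2 → ℂ := fun p =>
    ((n1 : ℂ) - 1 - 2 * ((p.1 : ℕ) : ℂ)) * z1 + ((n2 : ℂ) - 1 - 2 * ((p.2 : ℕ) : ℂ)) * z2 with hlam
  have hinj : Function.Injective lam := by
    intro p q hpq
    have := hind (n1 - 1 - 2 * (p.1 : ℕ)) (n1 - 1 - 2 * (q.1 : ℕ))
      (n2 - 1 - 2 * (p.2 : ℕ)) (n2 - 1 - 2 * (q.2 : ℕ))
      ⟨p.1, p.1.isLt, rfl⟩ ⟨q.1, q.1.isLt, rfl⟩ ⟨p.2, p.2.isLt, rfl⟩ ⟨q.2, q.2.isLt, rfl⟩ (by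
        simp only [hlam] at hpq
        push_cast
        linear_combination hpq)
    ext <;> omega
  have h0 : ∀ p, lam p ≠ 0 := by
    intro p hp
    have b1 := p.1.isLt
    have b2 := p.2.isLt
    have := hind (n1 - 1 - 2 * (p.1 : ℕ)) (n1 - 1 - 2 * (n1 - 1 - (p.1 : ℕ) : ℕ))
      (n2 - 1 - 2 * (p.2 : ℕ)) (n2 - 1 - 2 * (n2 - 1 - (p.2 : ℕ) : ℕ))
      ⟨p.1, p.1.isLt, rfl⟩ ⟨n1 - 1 - (p.1 : ℕ), by omega, rfl⟩
      ⟨p.2, p.2.isLt, rfl⟩ ⟨n2 - 1 - (p.2 : ℕ), by omega, rfl⟩ (by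
        simp only [hlam] at hp
        have c1 : ((n1 - 1 - (p.1 : ℕ) : ℕ) : ℂ) = (n1 : ℂ) - 1 - ((p.1 : ℕ) : ℂ) := by
          rw [Nat.cast_sub (by omega), Nat.cast_sub (by omega)]; simp
        have c2 : ((n2 - 1 - (p.2 : ℕ) : ℕ) : ℂ) = (n2 : ℂ) - 1 - ((p.2 : ℕ) : ℂ) := by
          rw [Nat.cast_sub (by omega), Nat.cast_sub (by omega)]; simp
        simp only [Int.cast_sub, Int.cast_mul, Int.cast_natCast, Int.cast_one, Int.cast_ofNat,
          c1, c2]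
        linear_combination 2 * hp)
    rcases Nat.even_mul.1 heven with h | h <;> obtain ⟨t, ht⟩ := h <;> omega
  have key : ∀ (p : Fin n1 × Fin n2) (_ : ℕ), ∃ w1 w2 : Fin (2 * (n1 * n2)) → ℂ,
      ∀ k : ℕ,
      (fun i => (algebraMap ℝ ℂ) ((e1v (2 * (n1 * n2)) ᵥ* (Qmat n1 n2 τ1 τ2 ^ k)) i)) ⬝ᵥ w1
        = lam p ^ k ∧
      (fun i => (algebraMap ℝ ℂ) ((e1v (2 * (n1 * n2)) ᵥ* (Qmat n1 n2 τ1 τ2 ^ k)) i)) ⬝ᵥ w2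
        = (k : ℂ) * lam p ^ (k - 1) := by
    intro p _
    set v : Fin n1 × Fin n2 → ℂ := fun q => kacVec n1 p.1 z1 q.1 * kacVec n2 p.2 z2 q.2 with hv
    have hK : kac2M ℂ n1 n2 τ1 τ2 *ᵥ v = lam p • v := by
      apply kac2M_mulVec
      · rw [← hz1]; exact kacM_mulVec n1 p.1 p.1.isLt z1
      · rw [← hz2]; exact kacM_mulVec n2 p.2 p.2.isLt z2
    set w1 : Fin (2 * (n1 * n2)) → ℂ := Sum.elim v 0 ∘ (idxE n1 n2).symm with hw1
    set w2 : Fin (2 * (n1 * n2)) → ℂ := Sum.elim 0 v ∘ (idxE n1 n2).symm with hw2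
    have hA1 : A *ᵥ w1 = lam p • w1 := by
      rw [hA, Qmat_map, hw1, Matrix.submatrix_mulVec_equiv]
      funext i
      obtain ⟨i, rfl⟩ := (idxE n1 n2).surjective i
      rcases i with i | i <;>
        simp [Function.comp_assoc, Matrix.fromBlocks_mulVec, hK]
    have hA2 : A *ᵥ w2 = w1 + lam p • w2 := by
      rw [hA, Qmat_map, hw1, hw2, Matrix.submatrix_mulVec_equiv]
      funext i
      obtain ⟨i, rfl⟩ := (idxE n1 n2).surjective i
      rcases i with i | i <;>
        simp [Function.comp_assoc, Matrix.fromBlocks_mulVec, hK]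
    have i0 : (idxE n1 n2) (Sum.inl (⟨0, by omega⟩, ⟨0, by omega⟩)) = ⟨0, by omega⟩ := by
      apply Fin.ext
      simp [idxE]
    have i0' : (idxE n1 n2).symm ⟨0, by omega⟩ = Sum.inl (⟨0, by omega⟩, ⟨0, by omega⟩) := by
      rw [← i0, Equiv.symm_apply_apply]
    have hd : ∀ w : Fin (2 * (n1 * n2)) → ℂ,
        (fun i => (algebraMap ℝ ℂ) (e1v (2 * (n1 * n2)) i)) ⬝ᵥ w = w ⟨0, by omega⟩ := by
      intro w
      rw [dotProduct, Finset.sum_eq_single ⟨0, by omega⟩]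
      · simp [e1v]
      · intro b _ hb
        have : (b : ℕ) ≠ 0 := fun h => hb (Fin.ext h)
        simp [e1v, this]
      · simp
    have hw10 : w1 ⟨0, by omega⟩ = 1 := by
      simp [hw1, i0', hv, kacVec, kacPoly_coeff_zero]
    have hw20 : w2 ⟨0, by omega⟩ = 0 := by
      simp [hw2, i0']
    refine ⟨w1, w2, fun k => ?_⟩
    have hrow : (fun i => (algebraMap ℝ ℂ) ((e1v (2 * (n1 * n2)) ᵥ* (Qmat n1 n2 τ1 τ2 ^ k)) i))
        = (fun i => (algebraMap ℝ ℂ) (e1v (2 * (n1 * n2)) i)) ᵥ* (A ^ k) := by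
      funext i
      rw [RingHom.map_vecMul, hA, Matrix.map_pow]
      rfl
    obtain ⟨g1, g2⟩ := pow_chain A (lam p) w1 w2 hA1 hA2 k
    rw [hrow, ← Matrix.dotProduct_mulVec, ← Matrix.dotProduct_mulVec, g1, g2, hd, hd]
    simp [hw10, hw20]
  rw [Fintype.linearIndependent_iff]
  intro c hc
  have hdot : ∀ w : Fin (2 * (n1 * n2)) → ℂ, ∑ k, (c k : ℂ) *
      ((fun i => (algebraMap ℝ ℂ) ((e1v (2 * (n1 * n2)) ᵥ*
        (Qmat n1 n2 τ1 τ2 ^ (s + (k : ℕ)))) i)) ⬝ᵥ w) = 0 := by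
    intro w
    simp only [dotProduct, Finset.mul_sum]
    rw [Finset.sum_comm]
    apply Finset.sum_eq_zero
    intro i _
    have h := congrArg (algebraMap ℝ ℂ) (congrFun hc i)
    simp only [Finset.sum_apply, Pi.smul_apply, smul_eq_mul, map_sum, map_mul, Pi.zero_apply,
      map_zero] at h
    simp only [← mul_assoc, ← Finset.sum_mul]
    rw [show (∑ k, (c k : ℂ) * (algebraMap ℝ ℂ) ((e1v (2 * (n1 * n2)) ᵥ*
        (Qmat n1 n2 τ1 τ2 ^ (s + (k : ℕ)))) i)) = 0 from h, zero_mul]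
  have hfin := poly_part (n1 * n2) s lam hinj (by simp) h0 (fun k => (c k : ℂ))
    (fun p => by
      obtain ⟨w1, w2, hw⟩ := key p 0
      have := hdot w1
      simpa only [(hw _).1] using this)
    (fun p => by
      obtain ⟨w1, w2, hw⟩ := key p 0
      have := hdot w2
      simpa only [(hw _).2] using this)
  intro k
  exact_mod_cast hfin k
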